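/- For the random transposition shuffle on S_3 started at the identity, for all m ≥ 1 the total variation distance between dist(X_m) and the uniform distribution U satisfies (1/2)·3^{-m} ≤ ||dist(X_m) − U||_{TV} ≤ (5/2)·3^{-m}. -/

import Mathlib

open Matrix Finset

theorem isSwap_iff_sign_eq_neg_one (σ : Equiv.Perm (Fin 3)) :
    σ.IsSwap ↔ Equiv.Perm.sign σ = -1 := by
  constructor
  · exact fun h => h.sign_eq
  · have h : ∀ σ : Equiv.Perm (Fin 3), Equiv.Perm.sign σ = -1 →
        ∃ x y, x ≠ y ∧ σ = Equiv.swap x y := by decide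
    exact h σ

theorem sum_perm_fin_three (f : Equiv.Perm (Fin 3) → ℝ) :
    ∑ τ, f τ = f 1 + f (Equiv.swap 0 1) + f (Equiv.swap 0 2) + f (Equiv.swap 1 2) +
      f (Equiv.swap 0 1 * Equiv.swap 1 2) + f (Equiv.swap 1 2 * Equiv.swap 0 1) := by
  have h : (univ : Finset (Equiv.Perm (Fin 3))) =
      {1, Equiv.swap 0 1, Equiv.swap 0 2, Equiv.swap 1 2,
        Equiv.swap 0 1 * Equiv.swap 1 2, Equiv.swap 1 2 * Equiv.swap 0 1} := by decide
  rw [h, sum_insert (by decide), sum_insert (by decide), sum_insert (by decide),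
    sum_insert (by decide), sum_insert (by decide), sum_singleton]
  ring

/-- The sign of a permutation of three letters, as a real number. -/
def realSign (σ : Equiv.Perm (Fin 3)) : ℝ := ((Equiv.Perm.sign σ : ℤ) : ℝ)

theorem realSign_mul_self (σ : Equiv.Perm (Fin 3)) : realSign σ * realSign σ = 1 := by
  rcases Int.units_eq_one_or (Equiv.Perm.sign σ) with h | h <;> simp [realSign, h]

theorem sum_realSign : ∑ σ, realSign σ = 0 := by
  rw [sum_perm_fin_three]
  simp [realSign, Equiv.Perm.sign_swap']

/-- The kernel of the shuffle in terms of the trivial and the sign character. -/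
theorem transposition_kernel_eq (P : Matrix (Equiv.Perm (Fin 3)) (Equiv.Perm (Fin 3)) ℝ)
    (hP : open Classical in ∀ σ τ, P σ τ = (1 / 9) *
      (if σ = τ then 3 else if (τ * σ⁻¹).IsSwap then 2 else 0))
    (σ τ : Equiv.Perm (Fin 3)) :
    P σ τ = (1 / 3) * (if σ = τ then 1 else 0) + (1 / 9) * (1 - realSign σ * realSign τ) := by
  rw [hP, isSwap_iff_sign_eq_neg_one]
  by_cases h : σ = τ
  · subst h
    simp [realSign_mul_self]
    norm_num
  · rcases Int.units_eq_one_or (Equiv.Perm.sign σ) with h₁ | h₁ <;>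
      rcases Int.units_eq_one_or (Equiv.Perm.sign τ) with h₂ | h₂ <;>
      simp [h, realSign, h₁, h₂] <;> norm_num

theorem transposition_kernel_pow (P : Matrix (Equiv.Perm (Fin 3)) (Equiv.Perm (Fin 3)) ℝ)
    (hP : ∀ σ τ, P σ τ =
      (1 / 3) * (if σ = τ then 1 else 0) + (1 / 9) * (1 - realSign σ * realSign τ))
    (m : ℕ) (σ τ : Equiv.Perm (Fin 3)) :
    (P ^ m) σ τ = 1 / 6 + realSign σ * realSign τ / 6 * (-1 / 3) ^ m +
      ((if σ = τ then 1 else 0) - (1 + realSign σ * realSign τ) / 6) * (1 / 3) ^ m := by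
  induction m generalizing τ with
  | zero =>
    simp only [pow_zero, Matrix.one_apply]
    ring
  | succ m ih =>
    rw [pow_succ, Matrix.mul_apply]
    set a : ℝ := (-1 / 3) ^ m
    set b : ℝ := (1 / 3) ^ m
    have hsplit : ∀ ρ, (P ^ m) σ ρ * P ρ τ =
        (1 / 3) * (if ρ = τ then (P ^ m) σ τ else 0) + (1 / 9) * (1 / 6 - b / 6) +
        realSign ρ * ((1 / 9) * (realSign σ * (a - b) / 6 - (1 / 6 - b / 6) * realSign τ)) -
        (1 / 9) * (realSign σ * realSign τ * (a - b) / 6) +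
        (1 / 9) * b * (if σ = ρ then 1 - realSign σ * realSign τ else 0) := by
      intro ρ
      have hs := realSign_mul_self ρ
      rw [hP ρ τ, mul_add]
      have h₁ : (P ^ m) σ ρ * ((1 / 3) * (if ρ = τ then (1 : ℝ) else 0)) =
          (1 / 3) * (if ρ = τ then (P ^ m) σ τ else 0) := by
        split_ifs with h
        · rw [h]; ring
        · ring
      rw [h₁, ih ρ]
      split_ifs with h₂ h₃ h₃ <;> first | subst h₃ | skip
      all_goals
        linear_combination (-(1 / 9) * realSign σ * realSign τ * (a - b) / 6) * hs
    simp only [hsplit, sum_add_distrib, sum_sub_distrib, ← mul_sum, ← sum_mul, sum_realSign,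
      sum_ite_eq, sum_ite_eq', mem_univ, if_true, sum_const, card_univ, Fintype.card_perm,
      Fintype.card_fin, nsmul_eq_mul]
    rw [ih τ, pow_succ, pow_succ]
    norm_num [Nat.factorial]
    ring

open Classical in
/-- For the random transposition shuffle on `S₃` started at the identity, for all
`m ≥ 1`: `(1/2)·3^(-m) ≤ ‖dist(X_m) − U‖_TV ≤ (5/2)·3^(-m)`. -/
theorem stmt4 (P : Matrix (Equiv.Perm (Fin 3)) (Equiv.Perm (Fin 3)) ℝ)
    (hP : ∀ σ τ, P σ τ = (1 / 9) *
      (if σ = τ then 3 else if (τ * σ⁻¹).IsSwap then 2 else 0))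
    (m : ℕ) (hm : 1 ≤ m) :
    (1 / 2) * ((1 : ℝ) / 3) ^ m ≤
      (1 / 2) * ∑ τ : Equiv.Perm (Fin 3), |(P ^ m) 1 τ - 1 / 6| ∧
    (1 / 2) * ∑ τ : Equiv.Perm (Fin 3), |(P ^ m) 1 τ - 1 / 6| ≤
      (5 / 2) * ((1 : ℝ) / 3) ^ m := by
  have hpow := transposition_kernel_pow P (transposition_kernel_eq P hP) m 1
  have e₁ : realSign 1 = 1 := by simp [realSign]
  have e₂ : ∀ i j : Fin 3, i ≠ j → realSign (Equiv.swap i j) = -1 := fun i j h => by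
    simp [realSign, Equiv.Perm.sign_swap h]
  have e₃ : realSign (Equiv.swap 0 1 * Equiv.swap 1 2) = 1 := by
    simp [realSign, Equiv.Perm.sign_swap']
  have e₄ : realSign (Equiv.swap 1 2 * Equiv.swap 0 1) = 1 := by
    simp [realSign, Equiv.Perm.sign_swap']
  have hr : (0 : ℝ) < (1 / 3) ^ m := by positivity
  have ha : (-1 / 3 : ℝ) ^ m = (1 / 3) ^ m ∨ (-1 / 3 : ℝ) ^ m = -(1 / 3) ^ m := by
    rw [neg_div]
    exact (Nat.even_or_odd m).imp (fun h => h.neg_pow _) (fun h => h.neg_pow _)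
  rw [sum_perm_fin_three]
  simp only [hpow, e₁, e₂ 0 1 (by decide), e₂ 0 2 (by decide), e₂ 1 2 (by decide), e₃, e₄,
    if_true, if_neg (show (1 : Equiv.Perm (Fin 3)) ≠ Equiv.swap 0 1 by decide),
    if_neg (show (1 : Equiv.Perm (Fin 3)) ≠ Equiv.swap 0 2 by decide),
    if_neg (show (1 : Equiv.Perm (Fin 3)) ≠ Equiv.swap 1 2 by decide),
    if_neg (show (1 : Equiv.Perm (Fin 3)) ≠ Equiv.swap 0 1 * Equiv.swap 1 2 by decide),
    if_neg (show (1 : Equiv.Perm (Fin 3)) ≠ Equiv.swap 1 2 * Equiv.swap 0 1 by decide)]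
  generalize ((1 : ℝ) / 3) ^ m = r at hr ha ⊢
  rcases ha with ha | ha <;> rw [ha] <;> ring_nf <;>
    norm_num [abs_mul, abs_of_pos hr, abs_of_pos, abs_of_neg] <;>
    constructor <;> linarith
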